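/- The set B = {δ, −(φ₁+2φ₂+2φ₃), −(φ₁+φ₂+2φ₃+φ₄), φ₃} is a base of Δ, and the positive system determined by B equals Δ_k⁺ ∪ {β ∈ Δ_n⁺ : β ≥ φ₁+2φ₂+2φ₃+φ₄ or β ≥ φ₁+φ₂+2φ₃+2φ₄} ∪ (−{β ∈ Δ_n⁺ : β ≤ φ₁+2φ₂+2φ₃ or β ≤ φ₁+φ₂+2φ₃+φ₄}); in particular this positive system contains Δ_k⁺. -/

import Mathlib

noncomputable section

abbrev V : Type := Fin 4 → ℝ

def e (i : Fin 4) : V := Pi.single i 1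

/-- The root system of type F₄ in ℝ⁴ (48 vectors). -/
def Δ : Set V :=
  (⋃ i, ({e i, -e i} : Set V)) ∪
  (⋃ (i) (j) (_ : i < j), ({e i + e j, e i - e j, -e i + e j, -e i - e j} : Set V)) ∪
  {v | ∃ s : Fin 4 → ℝ, (∀ i, s i = 1 ∨ s i = -1) ∧ v = (1 / 2 : ℝ) • ∑ i, s i • e i}

def φ₁ : V := e 1 - e 2
def φ₂ : V := e 2 - e 3
def φ₃ : V := e 3
def φ₄ : V := (1 / 2 : ℝ) • (e 0 - e 1 - e 2 - e 3)

def φv : Fin 4 → V := ![φ₁, φ₂, φ₃, φ₄]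

/-- The coordinates `n₁(α), …, n₄(α)` of `α` with respect to the basis φ₁,…,φ₄:
for every `α : V` one has `α = ∑ i, n α i • φv i`. -/
def n (α : V) : Fin 4 → ℝ :=
  ![α 1 + α 0, α 1 + α 2 + 2 * α 0, α 1 + α 2 + α 3 + 3 * α 0, 2 * α 0]

/-- The highest root δ = 2φ₁+3φ₂+4φ₃+2φ₄ = e₁+e₂. -/
def δ : V := e 0 + e 1

/-- Compact roots: roots α with n₁(α) even. -/
def Δk : Set V := {α ∈ Δ | ∃ m : ℤ, n α 0 = 2 * m}

/-- Noncompact roots: roots α with n₁(α) odd. -/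
def Δn : Set V := {α ∈ Δ | ∃ m : ℤ, n α 0 = 2 * m + 1}

/-- Δ⁺: roots with all φ-coefficients nonnegative. -/
def Δp : Set V := {α ∈ Δ | ∀ i, 0 ≤ n α i}

def Δkp : Set V := Δp ∩ Δk
def Δnp : Set V := Δp ∩ Δn

/-- A positive system of Δ: the set of roots on which some root-regular linear
functional is positive. -/
def IsPosSystem (P : Set V) : Prop :=
  ∃ f : V →ₗ[ℝ] ℝ, (∀ α ∈ Δ, f α ≠ 0) ∧ P = {α ∈ Δ | 0 < f α}

/-- `le' γ β` means γ ≤ β, i.e. β − γ is a nonnegative integer combination of φ₁,…,φ₄. -/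
def le' (γ β : V) : Prop := ∃ c : Fin 4 → ℕ, β - γ = ∑ i, (c i : ℝ) • φv i

/-- A base of Δ: a linearly independent subset of Δ such that every root is an
integral combination with coefficients all ≥ 0 or all ≤ 0. -/
def IsBase (B : Finset V) : Prop :=
  ↑B ⊆ Δ ∧ LinearIndependent ℝ (Subtype.val : {x : V // x ∈ B} → V) ∧
  ∀ α ∈ Δ, ∃ c : V → ℤ,
    α = ∑ x ∈ B, (c x : ℝ) • x ∧ ((∀ x ∈ B, 0 ≤ c x) ∨ (∀ x ∈ B, c x ≤ 0))

/-- The positive system determined by a base B: roots whose B-coefficients are all ≥ 0. -/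
def posOf (B : Finset V) : Set V :=
  {α ∈ Δ | ∃ c : V → ℤ, α = ∑ x ∈ B, (c x : ℝ) • x ∧ ∀ x ∈ B, 0 ≤ c x}

lemma exists_int_n_of_half {v : V} (a : Fin 4 → ℤ) (hv : ∀ i, v i = a i / 2)
    (h₁ : Even (a 1 + a 0)) (h₂ : Even (a 1 + a 2)) (h₃ : Even (a 3 + a 0))
    (hsq : a 0 ^ 2 + a 1 ^ 2 + a 2 ^ 2 + a 3 ^ 2 ≤ 8) (hne : a ≠ 0) :
    ∃ k : Fin 4 → ℤ, (∀ i, n v i = k i) ∧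
      k 3 ^ 2 + (2 * k 0 - k 3) ^ 2 + (2 * k 1 - 2 * k 0 - k 3) ^ 2
        + (2 * k 2 - 2 * k 1 - k 3) ^ 2 ≤ 8 ∧ k ≠ 0 := by
  obtain ⟨x, hx⟩ := h₁
  obtain ⟨y, hy⟩ := h₂
  obtain ⟨z, hz⟩ := h₃
  refine ⟨![x, y + a 0, y + z + a 0, a 0], ?_, ?_, ?_⟩
  · have hx' : (a 1 + a 0 : ℝ) = x + x := by exact_mod_cast hx
    have hy' : (a 1 + a 2 : ℝ) = y + y := by exact_mod_cast hy
    have hz' : (a 3 + a 0 : ℝ) = z + z := by exact_mod_cast hz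
    intro i
    fin_cases i <;> simp [n, hv] <;> linarith
  · have e₁ : a 1 = 2 * x - a 0 := by linarith
    have e₂ : a 2 = 2 * (y + a 0) - 2 * x - a 0 := by linarith
    have e₃ : a 3 = 2 * (y + z + a 0) - 2 * (y + a 0) - a 0 := by linarith
    rw [e₁, e₂, e₃] at hsq
    simpa using hsq
  · intro h
    have h0 := congrFun h 0
    have h1 := congrFun h 1
    have h2 := congrFun h 2
    have h3 := congrFun h 3
    simp at h0 h1 h2 h3
    apply hne
    funext i
    fin_cases i <;> simp <;> omega

lemma e_apply (i j : Fin 4) : e i j = ((Pi.single i 2 : Fin 4 → ℤ) j : ℝ) / 2 := by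
  by_cases h : j = i
  · subst h; simp [e]
  · simp [e, h]

/-- The simple-root coordinates of a root are integers, not all zero, and the squared length
of a root is at most two. -/
lemma exists_int_n {v : V} (hv : v ∈ Δ) :
    ∃ k : Fin 4 → ℤ, (∀ i, n v i = k i) ∧
      k 3 ^ 2 + (2 * k 0 - k 3) ^ 2 + (2 * k 1 - 2 * k 0 - k 3) ^ 2
        + (2 * k 2 - 2 * k 1 - k 3) ^ 2 ≤ 8 ∧ k ≠ 0 := by
  rcases hv with (hv | hv) | ⟨s, hs, rfl⟩
  · simp only [Set.mem_iUnion, Set.mem_insert_iff, Set.mem_singleton_iff] at hv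
    obtain ⟨i, rfl | rfl⟩ := hv
    · refine exists_int_n_of_half (Pi.single i 2) (e_apply i) ?_ ?_ ?_ ?_ ?_ <;>
        decide +revert
    · refine exists_int_n_of_half (-Pi.single i 2)
        (fun j => by simp only [Pi.neg_apply, e_apply]; push_cast; ring) ?_ ?_ ?_ ?_ ?_ <;>
        decide +revert
  · simp only [Set.mem_iUnion, Set.mem_insert_iff, Set.mem_singleton_iff] at hv
    obtain ⟨i, j, hij, rfl | rfl | rfl | rfl⟩ := hv
    · refine exists_int_n_of_half (Pi.single i 2 + Pi.single j 2)
        (fun l => by simp only [Pi.add_apply, e_apply]; push_cast; ring) ?_ ?_ ?_ ?_ ?_ <;>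
        decide +revert
    · refine exists_int_n_of_half (Pi.single i 2 - Pi.single j 2)
        (fun l => by simp only [Pi.sub_apply, e_apply]; push_cast; ring) ?_ ?_ ?_ ?_ ?_ <;>
        decide +revert
    · refine exists_int_n_of_half (-Pi.single i 2 + Pi.single j 2)
        (fun l => by
          simp only [Pi.neg_apply, Pi.add_apply, e_apply]; push_cast; ring) ?_ ?_ ?_ ?_ ?_ <;>
        decide +revert
    · refine exists_int_n_of_half (-Pi.single i 2 - Pi.single j 2)
        (fun l => by
          simp only [Pi.neg_apply, Pi.sub_apply, e_apply]; push_cast; ring) ?_ ?_ ?_ ?_ ?_ <;>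
        decide +revert
  · have ht : ∀ i, ∃ t : ℤ, s i = t ∧ (t = 1 ∨ t = -1) := fun i => by
      rcases hs i with h | h
      · exact ⟨1, by simp [h], Or.inl rfl⟩
      · exact ⟨-1, by simp [h], Or.inr rfl⟩
    choose t hst ht using ht
    have hodd : ∀ i, Odd (t i) := fun i => by
      rcases ht i with h | h <;> rw [h] <;> decide
    have hsq : ∀ i, t i ^ 2 = 1 := fun i => by
      rcases ht i with h | h <;> rw [h] <;> rfl
    refine exists_int_n_of_half t (fun i => ?_) ((hodd 1).add_odd (hodd 0))
      ((hodd 1).add_odd (hodd 2)) ((hodd 3).add_odd (hodd 0)) (by simp [hsq]) ?_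
    · simp [Finset.sum_apply, e, Pi.single_apply, hst]
      ring
    · intro h
      simpa [h] using hsq 0

lemma neg_mem_Δ {v : V} (hv : v ∈ Δ) : -v ∈ Δ := by
  rcases hv with (hv | hv) | ⟨s, hs, rfl⟩
  · refine Or.inl (Or.inl ?_)
    simp only [Set.mem_iUnion, Set.mem_insert_iff, Set.mem_singleton_iff] at hv ⊢
    obtain ⟨i, rfl | rfl⟩ := hv <;> exact ⟨i, by simp⟩
  · refine Or.inl (Or.inr ?_)
    simp only [Set.mem_iUnion, Set.mem_insert_iff, Set.mem_singleton_iff] at hv ⊢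
    obtain ⟨i, j, hij, rfl | rfl | rfl | rfl⟩ := hv
    · exact ⟨i, j, hij, .inr <| .inr <| .inr <| by abel⟩
    · exact ⟨i, j, hij, .inr <| .inr <| .inl <| by abel⟩
    · exact ⟨i, j, hij, .inr <| .inl <| by abel⟩
    · exact ⟨i, j, hij, .inl <| by abel⟩
  · refine Or.inr ⟨-s, fun i => ?_, by simp⟩
    rcases hs i with h | h <;> simp [h]

lemma n_neg (v : V) (i : Fin 4) : n (-v) i = -n v i := by
  fin_cases i <;> simp [n] <;> ring

/-- `B`, as an indexed family. -/
def bv : Fin 4 → V :=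
  ![δ, -(φ₁ + (2 : ℝ) • φ₂ + (2 : ℝ) • φ₃), -(φ₁ + φ₂ + (2 : ℝ) • φ₃ + φ₄), φ₃]

lemma eq_sum_bv_iff (v : V) (d : Fin 4 → ℝ) :
    v = ∑ i, d i • bv i ↔
      d 0 = n v 3 - 2 * n v 0 + n v 1 ∧ d 1 = n v 3 - n v 0 ∧
        d 2 = n v 3 - 4 * n v 0 + 2 * n v 1 ∧ d 3 = n v 2 - 2 * n v 0 := by
  rw [funext_iff]
  simp [Fin.forall_fin_succ, Fin.sum_univ_four, bv, n, δ, φ₁, φ₂, φ₃, φ₄, e, Pi.single_apply]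
  constructor
  · rintro ⟨h0, h1, h2, h3⟩
    refine ⟨?_, ?_, ?_, ?_⟩ <;> linarith
  · rintro ⟨h0, h1, h2, h3⟩
    refine ⟨?_, ?_, ?_, ?_⟩ <;> linarith

lemma eq_sum_φv_iff (v : V) (d : Fin 4 → ℝ) : v = ∑ i, d i • φv i ↔ ∀ i, d i = n v i := by
  rw [funext_iff]
  simp [Fin.forall_fin_succ, Fin.sum_univ_four, φv, n, φ₁, φ₂, φ₃, φ₄, e, Pi.single_apply]
  constructor
  · rintro ⟨h0, h1, h2, h3⟩
    refine ⟨?_, ?_, ?_, ?_⟩ <;> linarith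
  · rintro ⟨h0, h1, h2, h3⟩
    refine ⟨?_, ?_, ?_, ?_⟩ <;> linarith

lemma linearIndependent_bv : LinearIndependent ℝ bv := by
  rw [Fintype.linearIndependent_iff]
  intro g hg
  obtain ⟨h0, h1, h2, h3⟩ := (eq_sum_bv_iff 0 g).1 hg.symm
  simp [n] at h0 h1 h2 h3
  simp [Fin.forall_fin_succ, h0, h1, h2, h3]

lemma image_bv_eq : (Finset.univ.image bv : Finset V) =
    {δ, -(φ₁ + (2 : ℝ) • φ₂ + (2 : ℝ) • φ₃), -(φ₁ + φ₂ + (2 : ℝ) • φ₃ + φ₄), φ₃} := by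
  ext x
  simp [bv, Fin.exists_fin_succ, eq_comm]

lemma bv_mem_Δ (i : Fin 4) : bv i ∈ Δ := by
  fin_cases i
  · refine Or.inl (Or.inr ?_)
    simp only [Set.mem_iUnion]
    exact ⟨0, 1, by decide, by simp [bv, δ]⟩
  · refine Or.inl (Or.inr ?_)
    simp only [Set.mem_iUnion]
    refine ⟨1, 2, by decide, .inr <| .inr <| .inr ?_⟩
    simp only [bv, φ₁, φ₂, φ₃, Set.mem_singleton_iff]
    change -_ = _
    module
  · refine Or.inr ⟨![-1, -1, 1, -1], ?_, ?_⟩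
    · simp [Fin.forall_fin_succ]
    · simp only [bv, φ₁, φ₂, φ₃, φ₄, Fin.sum_univ_four]
      change -_ = (1 / 2 : ℝ) • ((-1 : ℝ) • e 0 + (-1 : ℝ) • e 1 + (1 : ℝ) • e 2 + (-1 : ℝ) • e 3)
      module
  · refine Or.inl (Or.inl ?_)
    simp only [Set.mem_iUnion]
    exact ⟨3, by simp [bv, φ₃]⟩

/-- The coordinates in the basis `bv` of the vector with simple-root coordinates `k`. -/
def bCoeff (k : Fin 4 → ℤ) : Fin 4 → ℤ :=
  ![k 3 - 2 * k 0 + k 1, k 3 - k 0, k 3 - 4 * k 0 + 2 * k 1, k 2 - 2 * k 0]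

lemma eq_sum_int_bv_iff {v : V} {k : Fin 4 → ℤ} (hk : ∀ i, n v i = k i) (d : Fin 4 → ℤ) :
    v = ∑ i, (d i : ℝ) • bv i ↔ d = bCoeff k := by
  rw [eq_sum_bv_iff v fun i => (d i : ℝ), funext_iff]
  simp only [hk, Fin.forall_fin_succ, bCoeff]
  norm_cast
  simp

lemma sum_image_bv (c : V → ℤ) :
    ∑ x ∈ Finset.univ.image bv, (c x : ℝ) • x = ∑ i, (c (bv i) : ℝ) • bv i :=
  Finset.sum_image linearIndependent_bv.injective.injOn

lemma exists_int_sum_image_bv {v : V} {k : Fin 4 → ℤ} (hk : ∀ i, n v i = k i) :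
    ∃ c : V → ℤ, v = ∑ x ∈ Finset.univ.image bv, (c x : ℝ) • x ∧
      ∀ i, c (bv i) = bCoeff k i := by
  have h : ∀ i, Function.extend bv (bCoeff k) 0 (bv i) = bCoeff k i :=
    linearIndependent_bv.injective.extend_apply _ _
  refine ⟨Function.extend bv (bCoeff k) 0, ?_, h⟩
  rw [sum_image_bv, eq_sum_int_bv_iff hk]
  exact funext h

lemma mem_posOf_iff {v : V} {k : Fin 4 → ℤ} (hv : v ∈ Δ) (hk : ∀ i, n v i = k i) :
    v ∈ posOf (Finset.univ.image bv) ↔ ∀ i, 0 ≤ bCoeff k i := by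
  constructor
  · rintro ⟨-, c, hc, hpos⟩ i
    rw [sum_image_bv, eq_sum_int_bv_iff hk fun i => c (bv i)] at hc
    rw [← hc]
    exact hpos _ (by simp)
  · intro h
    obtain ⟨c, hc, hck⟩ := exists_int_sum_image_bv hk
    exact ⟨hv, c, hc, by simpa [hck] using h⟩

lemma n_sub (v w : V) (i : Fin 4) : n (v - w) i = n v i - n w i := by
  fin_cases i <;> simp [n] <;> ring

lemma le'_iff {v w : V} {k l : Fin 4 → ℤ} (hv : ∀ i, n v i = k i) (hw : ∀ i, n w i = l i) :
    le' v w ↔ ∀ i, k i ≤ l i := by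
  have key : ∀ c : Fin 4 → ℕ, w - v = ∑ i, (c i : ℝ) • φv i ↔ ∀ i, (c i : ℤ) = l i - k i := by
    intro c
    rw [eq_sum_φv_iff _ fun i => (c i : ℝ)]
    refine forall_congr' fun i => ?_
    rw [n_sub, hv, hw]
    norm_cast
  simp only [le', key]
  constructor
  · rintro ⟨c, hc⟩ i
    have := hc i
    omega
  · exact fun h => ⟨fun i => (l i - k i).toNat, fun i => Int.toNat_of_nonneg (sub_nonneg.2 (h i))⟩

lemma bounds_of_normSq_le {k : Fin 4 → ℤ}
    (h : k 3 ^ 2 + (2 * k 0 - k 3) ^ 2 + (2 * k 1 - 2 * k 0 - k 3) ^ 2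
        + (2 * k 2 - 2 * k 1 - k 3) ^ 2 ≤ 8) :
    k 0 ∈ Finset.Icc (-2) 2 ∧ k 1 ∈ Finset.Icc (-4) 4 ∧ k 2 ∈ Finset.Icc (-6) 6 ∧
      k 3 ∈ Finset.Icc (-2) 2 := by
  have sq : ∀ x : ℤ, x ^ 2 ≤ 8 → -2 ≤ x ∧ x ≤ 2 := fun x hx =>
    ⟨by nlinarith, by nlinarith⟩
  have p0 := sq_nonneg (k 3)
  have p1 := sq_nonneg (2 * k 0 - k 3)
  have p2 := sq_nonneg (2 * k 1 - 2 * k 0 - k 3)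
  have p3 := sq_nonneg (2 * k 2 - 2 * k 1 - k 3)
  have q0 := sq (k 3) (by linarith)
  have q1 := sq (2 * k 0 - k 3) (by linarith)
  have q2 := sq (2 * k 1 - 2 * k 0 - k 3) (by linarith)
  have q3 := sq (2 * k 2 - 2 * k 1 - k 3) (by linarith)
  simp only [Finset.mem_Icc]
  omega

lemma root_coords_box :
    ∀ a ∈ Finset.Icc (-2 : ℤ) 2, ∀ b ∈ Finset.Icc (-4 : ℤ) 4, ∀ c ∈ Finset.Icc (-6 : ℤ) 6,
      ∀ d ∈ Finset.Icc (-2 : ℤ) 2,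
      d ^ 2 + (2 * a - d) ^ 2 + (2 * b - 2 * a - d) ^ 2 + (2 * c - 2 * b - d) ^ 2 ≤ 8 →
      ![a, b, c, d] ≠ 0 →
      ((∀ i, 0 ≤ bCoeff ![a, b, c, d] i) ∨ (∀ i, bCoeff ![a, b, c, d] i ≤ 0)) ∧
      ((∀ i, 0 ≤ bCoeff ![a, b, c, d] i) ↔
        ((∀ i, 0 ≤ ![a, b, c, d] i) ∧ a % 2 = 0 ∨
          ((∀ i, 0 ≤ ![a, b, c, d] i) ∧ a % 2 = 1 ∧
            ((∀ i, ![1, 2, 2, 1] i ≤ ![a, b, c, d] i) ∨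
              ∀ i, ![1, 1, 2, 2] i ≤ ![a, b, c, d] i))) ∨
          ((∀ i, 0 ≤ -![a, b, c, d] i) ∧ -a % 2 = 1 ∧
            ((∀ i, -![a, b, c, d] i ≤ ![1, 2, 2, 0] i) ∨
              ∀ i, -![a, b, c, d] i ≤ ![1, 1, 2, 1] i))) := by
  decide +kernel

lemma root_coords {k : Fin 4 → ℤ}
    (h : k 3 ^ 2 + (2 * k 0 - k 3) ^ 2 + (2 * k 1 - 2 * k 0 - k 3) ^ 2
        + (2 * k 2 - 2 * k 1 - k 3) ^ 2 ≤ 8) (h0 : k ≠ 0) :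
    ((∀ i, 0 ≤ bCoeff k i) ∨ (∀ i, bCoeff k i ≤ 0)) ∧
      ((∀ i, 0 ≤ bCoeff k i) ↔
        ((∀ i, 0 ≤ k i) ∧ k 0 % 2 = 0 ∨
          ((∀ i, 0 ≤ k i) ∧ k 0 % 2 = 1 ∧
            ((∀ i, ![1, 2, 2, 1] i ≤ k i) ∨ ∀ i, ![1, 1, 2, 2] i ≤ k i))) ∨
          ((∀ i, 0 ≤ -k i) ∧ -k 0 % 2 = 1 ∧
            ((∀ i, -k i ≤ ![1, 2, 2, 0] i) ∨ ∀ i, -k i ≤ ![1, 1, 2, 1] i))) := by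
  obtain ⟨b0, b1, b2, b3⟩ := bounds_of_normSq_le h
  have hk : k = ![k 0, k 1, k 2, k 3] := by
    funext i; fin_cases i <;> rfl
  have := root_coords_box _ b0 _ b1 _ b2 _ b3 h
  rw [← hk] at this
  exact this h0

lemma isBase_image_bv : IsBase (Finset.univ.image bv) := by
  refine ⟨?_, ?_, fun α hα => ?_⟩
  · intro x hx
    obtain ⟨i, -, rfl⟩ := Finset.mem_image.1 hx
    exact bv_mem_Δ i
  · have h := linearIndependent_bv.linearIndepOn_id
    have hr : Set.range bv = ((Finset.univ.image bv : Finset V) : Set V) := by simp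
    rw [hr] at h
    exact h
  · obtain ⟨k, hk, hsq, h0⟩ := exists_int_n hα
    obtain ⟨c, hc, hck⟩ := exists_int_sum_image_bv hk
    exact ⟨c, hc, by simpa [hck] using (root_coords hsq h0).1⟩

lemma mem_Δkp_iff {v : V} {k : Fin 4 → ℤ} (hv : v ∈ Δ) (hk : ∀ i, n v i = k i) :
    v ∈ Δkp ↔ (∀ i, 0 ≤ k i) ∧ k 0 % 2 = 0 := by
  simp only [Δkp, Δp, Δk, Set.mem_inter_iff, Set.mem_ofPred_eq, hv, true_and, hk]
  norm_cast
  rw [← Int.even_iff, even_iff_exists_two_mul]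

lemma mem_Δnp_iff {v : V} {k : Fin 4 → ℤ} (hv : v ∈ Δ) (hk : ∀ i, n v i = k i) :
    v ∈ Δnp ↔ (∀ i, 0 ≤ k i) ∧ k 0 % 2 = 1 := by
  simp only [Δnp, Δp, Δn, Set.mem_inter_iff, Set.mem_ofPred_eq, hv, true_and, hk]
  norm_cast
  rw [← Int.odd_iff, Odd]

lemma n_lower_bounds :
    (∀ i, n (φ₁ + (2 : ℝ) • φ₂ + (2 : ℝ) • φ₃ + φ₄) i = ((![1, 2, 2, 1] : Fin 4 → ℤ) i : ℝ)) ∧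
    (∀ i, n (φ₁ + φ₂ + (2 : ℝ) • φ₃ + (2 : ℝ) • φ₄) i =
      ((![1, 1, 2, 2] : Fin 4 → ℤ) i : ℝ)) := by
  simp [Fin.forall_fin_succ, n, φ₁, φ₂, φ₃, φ₄, e]
  norm_num

lemma n_upper_bounds :
    (∀ i, n (φ₁ + (2 : ℝ) • φ₂ + (2 : ℝ) • φ₃) i = ((![1, 2, 2, 0] : Fin 4 → ℤ) i : ℝ)) ∧
    (∀ i, n (φ₁ + φ₂ + (2 : ℝ) • φ₃ + φ₄) i = ((![1, 1, 2, 1] : Fin 4 → ℤ) i : ℝ)) := by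
  simp [Fin.forall_fin_succ, n, φ₁, φ₂, φ₃, φ₄, e]
  norm_num

theorem stmt16 :
    IsBase ({δ, -(φ₁ + (2 : ℝ) • φ₂ + (2 : ℝ) • φ₃), -(φ₁ + φ₂ + (2 : ℝ) • φ₃ + φ₄), φ₃} : Finset V) ∧
    posOf ({δ, -(φ₁ + (2 : ℝ) • φ₂ + (2 : ℝ) • φ₃), -(φ₁ + φ₂ + (2 : ℝ) • φ₃ + φ₄), φ₃} : Finset V) =
      Δkp ∪ {β ∈ Δnp | le' (φ₁ + (2 : ℝ) • φ₂ + (2 : ℝ) • φ₃ + φ₄) β ∨ le' (φ₁ + φ₂ + (2 : ℝ) • φ₃ + (2 : ℝ) • φ₄) β} ∪ (Neg.neg '' {β ∈ Δnp | le' β (φ₁ + (2 : ℝ) • φ₂ + (2 : ℝ) • φ₃) ∨ le' β (φ₁ + φ₂ + (2 : ℝ) • φ₃ + φ₄)}) ∧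
    Δkp ⊆ posOf ({δ, -(φ₁ + (2 : ℝ) • φ₂ + (2 : ℝ) • φ₃), -(φ₁ + φ₂ + (2 : ℝ) • φ₃ + φ₄), φ₃} : Finset V) := by
  rw [← image_bv_eq]
  have hpos : posOf (Finset.univ.image bv) =
      Δkp ∪ {β ∈ Δnp | le' (φ₁ + (2 : ℝ) • φ₂ + (2 : ℝ) • φ₃ + φ₄) β ∨ le' (φ₁ + φ₂ + (2 : ℝ) • φ₃ + (2 : ℝ) • φ₄) β} ∪ (Neg.neg '' {β ∈ Δnp | le' β (φ₁ + (2 : ℝ) • φ₂ + (2 : ℝ) • φ₃) ∨ le' β (φ₁ + φ₂ + (2 : ℝ) • φ₃ + φ₄)}) := by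
    ext v
    by_cases hv : v ∈ Δ
    · obtain ⟨k, hk, hsq, h0⟩ := exists_int_n hv
      have hk' : ∀ i, n (-v) i = ((-k) i : ℤ) := fun i => by simp [n_neg, hk]
      rw [mem_posOf_iff hv hk, (root_coords hsq h0).2, Set.image_neg_eq_neg]
      simp only [Set.mem_union, Set.mem_neg, Set.mem_ofPred_eq, mem_Δkp_iff hv hk,
        mem_Δnp_iff hv hk, mem_Δnp_iff (neg_mem_Δ hv) hk', le'_iff n_lower_bounds.1 hk,
        le'_iff n_lower_bounds.2 hk, le'_iff hk' n_upper_bounds.1,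
        le'_iff hk' n_upper_bounds.2, and_assoc, Pi.neg_apply]
    · refine iff_of_false (fun h => hv h.1) ?_
      rintro ((h | h) | ⟨w, h, rfl⟩)
      · exact hv h.1.1
      · exact hv h.1.1.1
      · exact hv (neg_mem_Δ h.1.1.1)
  refine ⟨isBase_image_bv, hpos, ?_⟩
  rw [hpos]
  exact Set.subset_union_left.trans Set.subset_union_left
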